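/- arXiv:1803.03669 — 3 statements merged into one kernel-verified Lean document; each statement's English description precedes it below -/
import Mathlib

section
/- Suppose ‖z̄ − h̄‖₂ ≤ δ√n for some δ ∈ [0,1]. Then every global minimizer ĝ of (TRS) satisfies (1/n)⟨h̄, ĝ⟩ ≥ 1 − 3δ/2 − (1/(2n))·h̄ᵀHh̄ + (1/(2n))·ĝᵀHĝ. -/
open scoped BigOperators
noncomputable section

namespace ModOne

/-- Grid points `x_i = (i-1)/(n-1)`, with `i : Fin n` zero-indexed. -/
def gridPt (n : ℕ) (i : Fin n) : ℝ := (i : ℝ) / ((n : ℝ) - 1)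

/-- Adjacency of the path-power graph: `i ≠ j` and `|i − j| ≤ k`. -/
def adj (n k : ℕ) (i j : Fin n) : Prop := i ≠ j ∧ |(i : ℤ) - (j : ℤ)| ≤ (k : ℤ)

instance adjDec (n k : ℕ) (i : Fin n) : DecidablePred (adj n k i) := fun j =>
  inferInstanceAs (Decidable (i ≠ j ∧ |(i : ℤ) - (j : ℤ)| ≤ (k : ℤ)))

/-- Degree of vertex `i` in the graph `G`. -/
def deg (n k : ℕ) (i : Fin n) : ℕ := (Finset.univ.filter (adj n k i)).card

/-- The graph Laplacian `L` of `G`. -/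
def lap (n k : ℕ) : Matrix (Fin n) (Fin n) ℝ := fun i j =>
  if i = j then (deg n k i : ℝ) else if adj n k i j then -1 else 0

/-- The block-diagonal matrix `H` with both diagonal blocks equal to `λL`. -/
def Hmat (n k : ℕ) (lam : ℝ) : Matrix (Fin n ⊕ Fin n) (Fin n ⊕ Fin n) ℝ :=
  Matrix.fromBlocks (lam • lap n k) 0 0 (lam • lap n k)

/-- The angular embedding `circ t = exp(2πι t)`. -/
def circ (t : ℝ) : ℂ := Complex.exp (2 * Real.pi * Complex.I * (t : ℂ))

/-- Real representation `(Re v, Im v) ∈ ℝ^{2n}` of a complex vector `v ∈ ℂ^n`. -/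
def embed (n : ℕ) (v : Fin n → ℂ) : Fin n ⊕ Fin n → ℝ :=
  Sum.elim (fun i => (v i).re) (fun i => (v i).im)

/-- Real representation of the angular embedding of a vector of values `t : Fin n → ℝ`. -/
def cvec (n : ℕ) (t : Fin n → ℝ) : Fin n ⊕ Fin n → ℝ := embed n (fun i => circ (t i))

/-- Quadratic form `vᵀ A v`. -/
def quad (n : ℕ) (A : Matrix (Fin n ⊕ Fin n) (Fin n ⊕ Fin n) ℝ) (v : Fin n ⊕ Fin n → ℝ) : ℝ :=
  ∑ i, v i * A.mulVec v i

/-- Euclidean inner product on `ℝ^{2n}`. -/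
def dotR (n : ℕ) (u v : Fin n ⊕ Fin n → ℝ) : ℝ := ∑ i, u i * v i

/-- Euclidean norm on `ℝ^{2n}`. -/
def norm2 (n : ℕ) (v : Fin n ⊕ Fin n → ℝ) : ℝ := Real.sqrt (∑ i, (v i) ^ 2)

/-- Feasibility for (TRS): `‖g‖₂² = n`. -/
def feasible (n : ℕ) (g : Fin n ⊕ Fin n → ℝ) : Prop := ∑ i, (g i) ^ 2 = (n : ℝ)

/-- The (TRS) objective `ḡᵀHḡ − 2ḡᵀz̄`. -/
def objective (n k : ℕ) (lam : ℝ) (zbar g : Fin n ⊕ Fin n → ℝ) : ℝ :=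
  quad n (Hmat n k lam) g - 2 * dotR n g zbar

/-- `g` is a global minimizer of (TRS) with data `z̄`. -/
def minimizer (n k : ℕ) (lam : ℝ) (zbar g : Fin n ⊕ Fin n → ℝ) : Prop :=
  feasible n g ∧ ∀ g', feasible n g' → objective n k lam zbar g ≤ objective n k lam zbar g'

/-- `z̄` is orthogonal to the null space `N(H)` of `H`. -/
def perpNull (n k : ℕ) (lam : ℝ) (z : Fin n ⊕ Fin n → ℝ) : Prop :=
  ∀ v, (Hmat n k lam).mulVec v = 0 → dotR n z v = 0

end ModOne

namespace ModOne

lemma feasible_cvec (n : ℕ) (t : Fin n → ℝ) : feasible n (cvec n t) := by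
  have hcirc (i : Fin n) : (circ (t i)).re ^ 2 + (circ (t i)).im ^ 2 = 1 := by
    have hnorm : ‖circ (t i)‖ = 1 := by
      rw [circ, show (2 * Real.pi * Complex.I * (t i : ℂ) : ℂ)
        = ((2 * Real.pi * t i : ℝ) : ℂ) * Complex.I by push_cast; ring]
      exact Complex.norm_exp_ofReal_mul_I _
    have hsq := Complex.sq_norm (circ (t i))
    rw [hnorm, Complex.normSq_apply] at hsq
    linarith
  simp only [feasible, cvec, embed, Fintype.sum_sum_type, Sum.elim_inl, Sum.elim_inr,
    ← Finset.sum_add_distrib, hcirc]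
  simp

lemma sum_sub_sq (n : ℕ) (u v : Fin n ⊕ Fin n → ℝ) :
    ∑ i, (u - v) i ^ 2 = ∑ i, u i ^ 2 - 2 * dotR n v u + ∑ i, v i ^ 2 := by
  rw [dotR, Finset.mul_sum, ← Finset.sum_sub_distrib, ← Finset.sum_add_distrib]
  exact Finset.sum_congr rfl fun i _ => by rw [Pi.sub_apply]; ring

lemma dotR_sub (n : ℕ) (g u v : Fin n ⊕ Fin n → ℝ) :
    dotR n g (u - v) = dotR n g u - dotR n v g := by
  rw [dotR, dotR, dotR, ← Finset.sum_sub_distrib]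
  exact Finset.sum_congr rfl fun i _ => by rw [Pi.sub_apply]; ring

end ModOne

open ModOne in
/-- Suppose `‖z̄ − h̄‖₂ ≤ δ√n` for some `δ ∈ [0,1]`. Then every global
minimizer `ĝ` of (TRS) satisfies
`(1/n)⟨h̄, ĝ⟩ ≥ 1 − 3δ/2 − (1/(2n))·h̄ᵀHh̄ + (1/(2n))·ĝᵀHĝ`. -/
theorem statement2 (n k : ℕ) (hn : 2 ≤ n) (hk₁ : 1 ≤ k) (hk₂ : k ≤ n - 1)
    (lam : ℝ) (hlam : 0 ≤ lam)
    (f : ℝ → ℝ) (y : Fin n → ℝ) (hy : ∀ i, y i ∈ Set.Ico (0:ℝ) 1)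
    (δ : ℝ) (hδ : δ ∈ Set.Icc (0:ℝ) 1)
    (hnoise : norm2 n (cvec n y - cvec n (fun i => f (gridPt n i))) ≤ δ * Real.sqrt n)
    (g : Fin n ⊕ Fin n → ℝ) (hg : minimizer n k lam (cvec n y) g) :
    (1 / (n:ℝ)) * dotR n (cvec n (fun i => f (gridPt n i))) g ≥
      1 - 3 * δ / 2
        - (1 / (2 * (n:ℝ))) * quad n (Hmat n k lam) (cvec n (fun i => f (gridPt n i)))
        + (1 / (2 * (n:ℝ))) * quad n (Hmat n k lam) g := by
  obtain ⟨hδ₀, hδ₁⟩ := hδ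
  obtain ⟨hgn, hmin⟩ := hg
  set h := cvec n (fun i => f (gridPt n i))
  set z := cvec n y
  have hnpos : (0 : ℝ) < n := by exact_mod_cast (by omega : 0 < n)
  have hhn : feasible n h := feasible_cvec n _
  have hzn : feasible n z := feasible_cvec n _
  have hopt := hmin h hhn
  have hcs : dotR n g (z - h) ≤ √(∑ i, g i ^ 2) * √(∑ i, (z - h) i ^ 2) :=
    Real.sum_mul_le_sqrt_mul_sqrt _ _ _
  have hexp := sum_sub_sq n z h
  have hdiff := dotR_sub n g z h
  unfold feasible at hgn hhn hzn
  unfold norm2 at hnoise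
  unfold objective at hopt
  have hsqrt : √(n : ℝ) * √(n : ℝ) = n := Real.mul_self_sqrt hnpos.le
  have hnoise_sq : ∑ i, (z - h) i ^ 2 ≤ δ ^ 2 * n := by
    have hle := (Real.sqrt_le_left (by positivity)).1 hnoise
    rwa [mul_pow, Real.sq_sqrt hnpos.le] at hle
  have hcross : dotR n g (z - h) ≤ δ * n := by
    rw [hgn] at hcs
    have hmul := mul_le_mul_of_nonneg_left hnoise (Real.sqrt_nonneg (n : ℝ))
    linear_combination hcs + hmul + δ * hsqrt
  have hδsq : δ ^ 2 * n ≤ δ * n :=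
    mul_le_mul_of_nonneg_right (by nlinarith) hnpos.le
  have hkey : (1 - 3 * δ / 2) * n - quad n (Hmat n k lam) h / 2 + quad n (Hmat n k lam) g / 2
      ≤ dotR n h g := by
    linarith
  calc (1 / (n : ℝ)) * dotR n h g
      ≥ (1 / (n : ℝ)) * ((1 - 3 * δ / 2) * n - quad n (Hmat n k lam) h / 2
          + quad n (Hmat n k lam) g / 2) :=
        mul_le_mul_of_nonneg_left hkey (by positivity)
    _ = _ := by field_simp
end
end

section
/- If n ≥ 2, then (1/(2n))·h̄ᵀHh̄ ≤ λπ²M²(2k)^{2α+1}/n^{2α}. -/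
open scoped BigOperators
noncomputable section

namespace ModOne

lemma circ_re (t : ℝ) : (circ t).re = Real.cos (2 * Real.pi * t) := by
  have h : circ t = Complex.exp (((2 * Real.pi * t : ℝ) : ℂ) * Complex.I) := by
    unfold circ
    congr 1
    push_cast
    ring
  rw [h, Complex.exp_ofReal_mul_I_re]

lemma circ_im (t : ℝ) : (circ t).im = Real.sin (2 * Real.pi * t) := by
  have h : circ t = Complex.exp (((2 * Real.pi * t : ℝ) : ℂ) * Complex.I) := by
    unfold circ
    congr 1
    push_cast
    ring
  rw [h, Complex.exp_ofReal_mul_I_im]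

lemma circ_sub_sq_le (s t : ℝ) :
    ((circ s).re - (circ t).re) ^ 2 + ((circ s).im - (circ t).im) ^ 2
      ≤ 4 * Real.pi ^ 2 * (s - t) ^ 2 := by
  simp only [circ_re, circ_im]
  have h := Real.one_sub_sq_div_two_le_cos (x := 2 * Real.pi * s - 2 * Real.pi * t)
  rw [Real.cos_sub] at h
  nlinarith [Real.sin_sq_add_cos_sq (2 * Real.pi * s), Real.sin_sq_add_cos_sq (2 * Real.pi * t)]

lemma adj_comm (n k : ℕ) (i j : Fin n) : adj n k i j ↔ adj n k j i := by
  unfold adj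
  rw [ne_comm, abs_sub_comm]

lemma deg_le (n k : ℕ) (i : Fin n) : deg n k i ≤ 2 * k := by
  have hcard : ((Finset.Icc ((i : ℤ) - k) (i + k)).erase (i : ℤ)).card = 2 * k := by
    rw [Finset.card_erase_of_mem (by simp), Int.card_Icc]
    omega
  rw [← hcard]
  refine Finset.card_le_card_of_injOn (fun j : Fin n => (j : ℤ)) ?_ ?_
  · intro j hj
    obtain ⟨hne, hle⟩ := (Finset.mem_filter.mp hj).2
    rw [abs_le] at hle
    have hne' : (i : ℕ) ≠ j := fun h => hne (Fin.ext h)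
    simp only [Finset.coe_erase, Finset.coe_Icc, Set.mem_sdiff, Set.mem_Icc,
      Set.mem_singleton_iff]
    omega
  · intro a _ b _ hab
    exact Fin.ext (by simpa using hab)

lemma lap_mulVec (n k : ℕ) (v : Fin n → ℝ) (i : Fin n) :
    (lap n k).mulVec v i = ∑ j, if adj n k i j then v i - v j else 0 := by
  have hpt : ∀ j, lap n k i j * v j =
      (if i = j then (deg n k i : ℝ) * v i else 0) - (if adj n k i j then v j else 0) := by
    intro j
    by_cases hij : i = j
    · subst hij
      have hn : ¬ adj n k i i := fun h => h.1 rfl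
      simp [lap, hn]
    · by_cases ha : adj n k i j <;> simp [lap, hij, ha]
  have hsplit : ∀ j, (if adj n k i j then v i - v j else 0) =
      (if adj n k i j then v i else 0) - (if adj n k i j then v j else 0) := by
    intro j
    split_ifs <;> simp
  simp only [Matrix.mulVec, dotProduct, hpt, hsplit, Finset.sum_sub_distrib]
  congr 1
  rw [← Finset.sum_filter, ← Finset.sum_filter]
  simp [deg, Finset.filter_eq]

lemma lap_quad (n k : ℕ) (v : Fin n → ℝ) :
    ∑ i, v i * (lap n k).mulVec v i =
      (1 / 2) * ∑ i, ∑ j, if adj n k i j then (v i - v j) ^ 2 else 0 := by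
  simp only [lap_mulVec, Finset.mul_sum]
  have hswap : ∑ i, ∑ j, v i * (if adj n k i j then v i - v j else 0) =
      ∑ i, ∑ j, v j * (if adj n k i j then v j - v i else 0) := by
    rw [Finset.sum_comm]
    refine Finset.sum_congr rfl fun i _ => Finset.sum_congr rfl fun j _ => ?_
    simp only [adj_comm n k j i]
  have hsum : ∑ i, ∑ j, v i * (if adj n k i j then v i - v j else 0) +
      ∑ i, ∑ j, v j * (if adj n k i j then v j - v i else 0) =
      2 * ∑ i, ∑ j, 1 / 2 * (if adj n k i j then (v i - v j) ^ 2 else 0) := by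
    simp only [Finset.mul_sum, ← Finset.sum_add_distrib]
    refine Finset.sum_congr rfl fun i _ => Finset.sum_congr rfl fun j _ => ?_
    split_ifs <;> ring
  linarith

lemma quad_Hmat_embed (n k : ℕ) (lam : ℝ) (v : Fin n → ℂ) :
    quad n (Hmat n k lam) (embed n v) = lam / 2 * ∑ i, ∑ j, if adj n k i j then
      ((v i).re - (v j).re) ^ 2 + ((v i).im - (v j).im) ^ 2 else 0 := by
  have hsplit : ∀ i j, (if adj n k i j then
      ((v i).re - (v j).re) ^ 2 + ((v i).im - (v j).im) ^ 2 else 0) =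
      (if adj n k i j then ((v i).re - (v j).re) ^ 2 else 0) +
      (if adj n k i j then ((v i).im - (v j).im) ^ 2 else 0) := by
    intro i j
    split_ifs <;> simp
  have hre := lap_quad n k fun i => (v i).re
  have him := lap_quad n k fun i => (v i).im
  have hquad : quad n (Hmat n k lam) (embed n v) =
      lam * ∑ i, (v i).re * (lap n k).mulVec (fun i => (v i).re) i +
      lam * ∑ i, (v i).im * (lap n k).mulVec (fun i => (v i).im) i := by
    simp only [quad, Hmat, embed, Fintype.sum_sum_type, Matrix.fromBlocks_mulVec, Finset.mul_sum]
    congr 1 <;>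
    · refine Finset.sum_congr rfl fun i _ => ?_
      simp [Function.comp_def, Matrix.smul_mulVec]
      ring
  simp only [hquad, hre, him, hsplit, Finset.sum_add_distrib]
  ring

lemma gridPt_mem_Icc (n : ℕ) (hn : 2 ≤ n) (i : Fin n) : gridPt n i ∈ Set.Icc (0 : ℝ) 1 := by
  have h2 : (2 : ℝ) ≤ n := by exact_mod_cast hn
  have hi : (i : ℝ) + 1 ≤ n := by exact_mod_cast i.isLt
  refine ⟨div_nonneg (Nat.cast_nonneg _) (by linarith), ?_⟩
  rw [gridPt, div_le_one (by linarith)]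
  linarith

lemma abs_gridPt_sub_le (n k : ℕ) (hn : 2 ≤ n) (i j : Fin n) (h : adj n k i j) :
    |gridPt n i - gridPt n j| ≤ 2 * k / n := by
  have h2 : (2 : ℝ) ≤ n := by exact_mod_cast hn
  have hk : |(i : ℝ) - (j : ℝ)| ≤ k := by exact_mod_cast h.2
  rw [gridPt, gridPt, ← sub_div, abs_div, abs_of_pos (by linarith : (0 : ℝ) < n - 1),
    div_le_div_iff₀ (by linarith) (by linarith)]
  nlinarith [(Nat.cast_nonneg k : (0 : ℝ) ≤ k)]

end ModOne

open ModOne in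
/-- If `n ≥ 2`, then `(1/(2n))·h̄ᵀHh̄ ≤ λπ²M²(2k)^{2α+1}/n^{2α}`,
where `f` is `(M,α)`-Hölder on `[0,1]`. -/
theorem statement3 (n k : ℕ) (hn : 2 ≤ n) (hk₁ : 1 ≤ k) (hk₂ : k ≤ n - 1)
    (lam : ℝ) (hlam : 0 ≤ lam)
    (f : ℝ → ℝ) (M α : ℝ) (hM : 0 < M) (hα : α ∈ Set.Ioc (0:ℝ) 1)
    (hf : ∀ x ∈ Set.Icc (0:ℝ) 1, ∀ y ∈ Set.Icc (0:ℝ) 1, |f x - f y| ≤ M * |x - y| ^ α) :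
    (1 / (2 * (n:ℝ))) * quad n (Hmat n k lam) (cvec n (fun i => f (gridPt n i))) ≤
      lam * Real.pi ^ 2 * M ^ 2 * (2 * (k:ℝ)) ^ (2 * α + 1) / (n:ℝ) ^ (2 * α) := by
  have hn0 : (0 : ℝ) < n := by exact_mod_cast (by omega : 0 < n)
  have hk0 : (0 : ℝ) < k := by exact_mod_cast hk₁
  have hr : (0 : ℝ) ≤ 2 * k / n := by positivity
  set C : ℝ := 4 * Real.pi ^ 2 * (M ^ 2 * (2 * k / n : ℝ) ^ (2 * α)) with hC
  have hC0 : 0 ≤ C := by positivity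
  have hpt : ∀ i j, adj n k i j →
      ((circ (f (gridPt n i))).re - (circ (f (gridPt n j))).re) ^ 2 +
      ((circ (f (gridPt n i))).im - (circ (f (gridPt n j))).im) ^ 2 ≤ C := by
    intro i j h
    refine (circ_sub_sq_le _ _).trans ?_
    have hb : |f (gridPt n i) - f (gridPt n j)| ≤ M * (2 * k / n : ℝ) ^ α :=
      (hf _ (gridPt_mem_Icc n hn i) _ (gridPt_mem_Icc n hn j)).trans
        (mul_le_mul_of_nonneg_left
          (Real.rpow_le_rpow (abs_nonneg _) (abs_gridPt_sub_le n k hn i j h) hα.1.le) hM.le)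
    have hsq := pow_le_pow_left₀ (abs_nonneg _) hb 2
    rw [sq_abs, mul_pow, ← Real.rpow_mul_natCast hr, Nat.cast_ofNat, mul_comm α 2] at hsq
    exact mul_le_mul_of_nonneg_left hsq (by positivity)
  have hrow : ∀ i : Fin n, (∑ j, if adj n k i j then
      ((circ (f (gridPt n i))).re - (circ (f (gridPt n j))).re) ^ 2 +
      ((circ (f (gridPt n i))).im - (circ (f (gridPt n j))).im) ^ 2 else 0) ≤ 2 * k * C := by
    intro i
    rw [← Finset.sum_filter]
    refine (Finset.sum_le_card_nsmul _ _ C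
      fun j hj => hpt i j (Finset.mem_filter.mp hj).2).trans ?_
    rw [nsmul_eq_mul]
    have hd : (deg n k i : ℝ) ≤ 2 * k := by exact_mod_cast deg_le n k i
    exact mul_le_mul_of_nonneg_right hd hC0
  have hsum := Finset.sum_le_card_nsmul Finset.univ _ _ fun i _ => hrow i
  rw [Finset.card_univ, Fintype.card_fin, nsmul_eq_mul] at hsum
  rw [cvec, quad_Hmat_embed]
  calc _ ≤ 1 / (2 * (n : ℝ)) * (lam / 2 * (n * (2 * k * C))) := by gcongr
    _ = _ := by
      rw [hC, Real.div_rpow (by positivity) hn0.le, Real.rpow_add (by positivity), Real.rpow_one]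
      field_simp
      ring
end
end

section
/- Assume m ≥ 2 and ‖z̄ − h̄‖₂ ≤ δ√n for some δ ∈ [0,1]. If z̄ is not orthogonal to N(H), then (TRS) has a unique global minimizer ĝ, and it satisfies (1/n)⟨h̄, ĝ⟩ ≥ 1 − 3δ/2 − λπ²M²(2k)^{2α}·d^{2α}·((2k+1)^d − 1)/n^{2α/d} + (1/(2λ((2k+1)^d − 1) + 1)²)·(1/(2n))·z̄ᵀHz̄. -/
open scoped BigOperators
noncomputable section

namespace ModOneMulti

/-- Index set of the `d`-dimensional grid: `V = {1,…,m}^d`. -/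
abbrev V (d m : ℕ) := Fin d → Fin m

/-- Grid point `x_𝐢 ∈ [0,1]^d` indexed by `𝐢 ∈ V`. -/
def gridPt (d m : ℕ) (i : V d m) : Fin d → ℝ := fun t => (i t : ℝ) / ((m : ℝ) - 1)

/-- Adjacency: `𝐢 ≠ 𝐣` and `‖𝐢 − 𝐣‖_∞ ≤ k`. -/
def adj (d m k : ℕ) (i j : V d m) : Prop :=
  i ≠ j ∧ ∀ t, |(i t : ℤ) - (j t : ℤ)| ≤ (k : ℤ)

instance adjDec (d m k : ℕ) (i : V d m) : DecidablePred (adj d m k i) := fun j =>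
  inferInstanceAs (Decidable (i ≠ j ∧ ∀ t, |(i t : ℤ) - (j t : ℤ)| ≤ (k : ℤ)))

/-- Degree of vertex `𝐢` in the graph `G`. -/
def deg (d m k : ℕ) (i : V d m) : ℕ := (Finset.univ.filter (adj d m k i)).card

/-- The graph Laplacian `L` of `G`. -/
def lap (d m k : ℕ) : Matrix (V d m) (V d m) ℝ := fun i j =>
  if i = j then (deg d m k i : ℝ) else if adj d m k i j then -1 else 0

/-- The block-diagonal matrix `H` with both diagonal blocks equal to `λL`. -/
def Hmat (d m k : ℕ) (lam : ℝ) : Matrix (V d m ⊕ V d m) (V d m ⊕ V d m) ℝ :=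
  Matrix.fromBlocks (lam • lap d m k) 0 0 (lam • lap d m k)

/-- The angular embedding `circ t = exp(2πι t)`. -/
def circ (t : ℝ) : ℂ := Complex.exp (2 * Real.pi * Complex.I * (t : ℂ))

/-- Real representation `(Re v, Im v) ∈ ℝ^{2n}` of a complex vector `v ∈ ℂ^n`. -/
def embed (d m : ℕ) (v : V d m → ℂ) : V d m ⊕ V d m → ℝ :=
  Sum.elim (fun i => (v i).re) (fun i => (v i).im)

/-- Real representation of the angular embedding of values `t : V → ℝ`. -/
def cvec (d m : ℕ) (t : V d m → ℝ) : V d m ⊕ V d m → ℝ := embed d m (fun i => circ (t i))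

/-- Quadratic form `vᵀ A v`. -/
def quad (d m : ℕ) (A : Matrix (V d m ⊕ V d m) (V d m ⊕ V d m) ℝ)
    (v : V d m ⊕ V d m → ℝ) : ℝ := ∑ i, v i * A.mulVec v i

/-- Euclidean inner product on `ℝ^{2n}`. -/
def dotR (d m : ℕ) (u v : V d m ⊕ V d m → ℝ) : ℝ := ∑ i, u i * v i

/-- Euclidean norm on `ℝ^{2n}`. -/
def norm2 (d m : ℕ) (v : V d m ⊕ V d m → ℝ) : ℝ := Real.sqrt (∑ i, (v i) ^ 2)

/-- Feasibility for (TRS): `‖g‖₂² = n` with `n = m^d`. -/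
def feasible (d m : ℕ) (g : V d m ⊕ V d m → ℝ) : Prop := ∑ i, (g i) ^ 2 = ((m : ℝ)) ^ d

/-- The (TRS) objective `ḡᵀHḡ − 2ḡᵀz̄`. -/
def objective (d m k : ℕ) (lam : ℝ) (zbar g : V d m ⊕ V d m → ℝ) : ℝ :=
  quad d m (Hmat d m k lam) g - 2 * dotR d m g zbar

/-- `g` is a global minimizer of (TRS) with data `z̄`. -/
def minimizer (d m k : ℕ) (lam : ℝ) (zbar g : V d m ⊕ V d m → ℝ) : Prop :=
  feasible d m g ∧
    ∀ g', feasible d m g' → objective d m k lam zbar g ≤ objective d m k lam zbar g'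

/-- `z̄` is orthogonal to the null space `N(H)` of `H`. -/
def perpNull (d m k : ℕ) (lam : ℝ) (z : V d m ⊕ V d m → ℝ) : Prop :=
  ∀ v, (Hmat d m k lam).mulVec v = 0 → dotR d m z v = 0

/-- Euclidean norm on `ℝ^d`. -/
def enorm (d : ℕ) (x : Fin d → ℝ) : ℝ := Real.sqrt (∑ t, (x t) ^ 2)

end ModOneMulti

open Matrix in
theorem exists_shifted_solution {ι : Type*} [Fintype ι] [DecidableEq ι] (A : Matrix ι ι ℝ)
    (hsymm : A.IsSymm) (hpos : ∀ x, 0 ≤ x ⬝ᵥ A *ᵥ x) (z v : ι → ℝ) (hv : A *ᵥ v = 0)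
    (hzv : z ⬝ᵥ v ≠ 0) :
    ∃ μ : ℝ, 0 < μ ∧ μ ≤ 1 ∧ ∃ g : ι → ℝ, g ⬝ᵥ g = z ⬝ᵥ z ∧ A *ᵥ g + μ • g = z := by
  have hdet : ∀ μ : ℝ, 0 < μ → (A + μ • (1 : Matrix ι ι ℝ)).det ≠ 0 := by
    intro μ hμ h0
    obtain ⟨x, hx, hx0⟩ := Matrix.exists_mulVec_eq_zero_iff.mpr h0
    have h1 := congrArg (fun y => x ⬝ᵥ y) hx0
    simp only [add_mulVec, smul_mulVec, one_mulVec, dotProduct_add, dotProduct_smul,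
      dotProduct_zero, smul_eq_mul] at h1
    have h2 : 0 < x ⬝ᵥ x := by
      refine lt_of_le_of_ne (by simpa using dotProduct_star_self_nonneg x) fun h => hx ?_
      exact dotProduct_self_eq_zero.mp h.symm
    nlinarith [hpos x, mul_pos hμ h2]
  set G : ℝ → ι → ℝ := fun μ => (A + μ • (1 : Matrix ι ι ℝ))⁻¹ *ᵥ z with hG
  have hsol : ∀ μ, 0 < μ → A *ᵥ G μ + μ • G μ = z := by
    intro μ hμ
    have : (A + μ • (1 : Matrix ι ι ℝ)) *ᵥ G μ = z := by
      rw [hG]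
      simp only [mulVec_mulVec]
      rw [Matrix.mul_nonsing_inv _ (isUnit_iff_ne_zero.mpr (hdet μ hμ)), one_mulVec]
    simpa [add_mulVec, smul_mulVec] using this
  have hcont : ContinuousOn (fun μ => G μ ⬝ᵥ G μ) (Set.Ioi 0) := by
    have hc : Continuous fun μ : ℝ => A + μ • (1 : Matrix ι ι ℝ) := by fun_prop
    have h1 : ContinuousOn G (Set.Ioi 0) := by
      simp only [hG, Matrix.inv_def, Ring.inverse_eq_inv']
      have h2 : ContinuousOn (fun μ : ℝ => (A + μ • (1 : Matrix ι ι ℝ)).det⁻¹) (Set.Ioi 0) :=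
        hc.matrix_det.continuousOn.inv₀ fun μ hμ => hdet μ hμ
      have h3 : ContinuousOn (fun μ : ℝ => (A + μ • (1 : Matrix ι ι ℝ)).adjugate *ᵥ z)
          (Set.Ioi 0) := (hc.matrix_adjugate.matrix_mulVec continuous_const).continuousOn
      simp only [smul_mulVec]
      exact h2.smul h3
    simp only [dotProduct]
    exact continuousOn_finsetSum _ fun i _ =>
      (continuousOn_pi.mp h1 i).mul (continuousOn_pi.mp h1 i)
  have hone : G 1 ⬝ᵥ G 1 ≤ z ⬝ᵥ z := by
    have h := hsol 1 one_pos
    rw [one_smul] at h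
    have h1 : 0 ≤ (A *ᵥ G 1) ⬝ᵥ (A *ᵥ G 1) := by
      simpa using dotProduct_star_self_nonneg (A *ᵥ G 1)
    have h2 := hpos (G 1)
    rw [← h]
    simp only [dotProduct_add, add_dotProduct]
    rw [dotProduct_comm (A *ᵥ G 1) (G 1)]
    linarith
  have hvv : 0 ≤ v ⬝ᵥ v := by simpa using dotProduct_star_self_nonneg v
  have hzz : 0 ≤ z ⬝ᵥ z := by simpa using dotProduct_star_self_nonneg z
  have hcs : ∀ x w : ι → ℝ, (x ⬝ᵥ w) ^ 2 ≤ (x ⬝ᵥ x) * (w ⬝ᵥ w) := by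
    intro x w
    simpa [dotProduct, sq] using Finset.sum_mul_sq_le_sq_mul_sq Finset.univ x w
  have hv0 : 0 < v ⬝ᵥ v := by
    refine lt_of_le_of_ne hvv fun h => hzv ?_
    rw [dotProduct_self_eq_zero.mp h.symm, dotProduct_zero]
  have hz0 : 0 < z ⬝ᵥ z := by
    refine lt_of_le_of_ne hzz fun h => hzv ?_
    rw [dotProduct_self_eq_zero.mp h.symm, zero_dotProduct]
  have hμv : ∀ μ, 0 < μ → z ⬝ᵥ v = μ * (G μ ⬝ᵥ v) := by
    intro μ hμ
    have h1 : (A *ᵥ G μ) ⬝ᵥ v = 0 := by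
      rw [dotProduct_comm, dotProduct_mulVec, ← mulVec_transpose, hsymm.eq, hv, zero_dotProduct]
    conv_lhs => rw [← hsol μ hμ]
    rw [add_dotProduct, h1, smul_dotProduct, zero_add, smul_eq_mul]
  set ε : ℝ := Real.sqrt ((z ⬝ᵥ v) ^ 2 / ((z ⬝ᵥ z) * (v ⬝ᵥ v))) with hε
  have hε2 : ε ^ 2 = (z ⬝ᵥ v) ^ 2 / ((z ⬝ᵥ z) * (v ⬝ᵥ v)) := Real.sq_sqrt (by positivity)
  have hε0 : 0 < ε := Real.sqrt_pos.mpr (by positivity)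
  have hε1 : ε ≤ 1 := by
    exact Real.sqrt_le_one.mpr ((div_le_one (by positivity)).mpr (hcs z v))
  have hlow : z ⬝ᵥ z ≤ G ε ⬝ᵥ G ε := by
    have h1 := hμv ε hε0
    have h2 := hcs (G ε) v
    have h3 : ε ^ 2 * ((z ⬝ᵥ z) * (v ⬝ᵥ v)) = ε ^ 2 * (G ε ⬝ᵥ v) ^ 2 := by
      rw [hε2, div_mul_cancel₀ _ (by positivity), ← hε2, ← mul_pow, h1]
    have h4 := mul_left_cancel₀ (by positivity) h3
    rw [← h4] at h2
    exact le_of_mul_le_mul_right h2 hv0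
  obtain ⟨μ, hμ, hμz⟩ := intermediate_value_Icc' hε1
    (hcont.mono fun x hx => lt_of_lt_of_le hε0 hx.1) ⟨hone, hlow⟩
  have hμ0 := lt_of_lt_of_le hε0 hμ.1
  exact ⟨μ, hμ0, hμ.2, G μ, hμz, hsol μ hμ0⟩

open Matrix in
theorem shifted_quadratic_bound {ι : Type*} [Fintype ι] (A : Matrix ι ι ℝ)
    (hsymm : A.IsSymm) (hpos : ∀ x, 0 ≤ x ⬝ᵥ A *ᵥ x) {Λ : ℝ} (hΛ : 0 ≤ Λ)
    (hle : ∀ x, x ⬝ᵥ A *ᵥ x ≤ Λ * (x ⬝ᵥ x)) {μ : ℝ} (hμ0 : 0 ≤ μ) (hμ1 : μ ≤ 1)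
    (g z : ι → ℝ) (hz : A *ᵥ g + μ • g = z) :
    z ⬝ᵥ A *ᵥ z ≤ (Λ + 1) ^ 2 * (g ⬝ᵥ A *ᵥ g) := by
  set w := A *ᵥ g with hw
  have hadj : g ⬝ᵥ A *ᵥ w = w ⬝ᵥ w := by
    rw [dotProduct_mulVec, ← mulVec_transpose, hsymm.eq]
  have hs := hpos g
  have hu := hle w
  have hu0 := hpos w
  have ht0 : 0 ≤ w ⬝ᵥ w := by simpa using dotProduct_star_self_nonneg w
  have hexp : ∀ c : ℝ, 0 ≤ c ^ 2 * (g ⬝ᵥ w) - 2 * c * (w ⬝ᵥ w) + w ⬝ᵥ A *ᵥ w := by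
    intro c
    have h := hpos (c • g - w)
    simp only [mulVec_sub, mulVec_smul, sub_dotProduct, dotProduct_sub, smul_dotProduct,
      dotProduct_smul, smul_eq_mul, ← hw, hadj] at h
    linarith
  have ht : w ⬝ᵥ w ≤ Λ * (g ⬝ᵥ w) := by
    rcases hΛ.eq_or_lt with h | h
    · have h1 := hle g
      have h2 := hexp 1
      rw [← h] at hu h1 ⊢
      linarith
    · have := hexp Λ
      refine le_of_mul_le_mul_left ?_ h
      linarith
  have hquad : z ⬝ᵥ A *ᵥ z = w ⬝ᵥ A *ᵥ w + 2 * μ * (w ⬝ᵥ w) + μ ^ 2 * (g ⬝ᵥ w) := by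
    rw [← hz]
    simp only [mulVec_add, mulVec_smul, add_dotProduct, dotProduct_add, smul_dotProduct,
      dotProduct_smul, smul_eq_mul, ← hw, hadj]
    ring
  rw [hquad]
  have h1 : μ ^ 2 ≤ 1 := pow_le_one₀ hμ0 hμ1
  nlinarith [mul_le_mul_of_nonneg_left ht hΛ, mul_le_mul_of_nonneg_right h1 hs,
    mul_le_mul_of_nonneg_right hμ1 ht0]

open Matrix in
/-- Optimality gap on a sphere. -/
theorem shifted_objective_sub {ι : Type*} [Fintype ι] (A : Matrix ι ι ℝ)
    (hsymm : A.IsSymm) {μ : ℝ} (g g' z : ι → ℝ) (hz : A *ᵥ g + μ • g = z)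
    (hg : g' ⬝ᵥ g' = g ⬝ᵥ g) :
    (g' ⬝ᵥ A *ᵥ g' - 2 * (g' ⬝ᵥ z)) - (g ⬝ᵥ A *ᵥ g - 2 * (g ⬝ᵥ z)) =
      (g' - g) ⬝ᵥ A *ᵥ (g' - g) + μ * ((g' - g) ⬝ᵥ (g' - g)) := by
  have hadj : g ⬝ᵥ A *ᵥ g' = g' ⬝ᵥ A *ᵥ g := by
    rw [dotProduct_mulVec, ← mulVec_transpose, hsymm.eq, dotProduct_comm]
  rw [← hz]
  simp only [mulVec_sub, sub_dotProduct, dotProduct_sub, dotProduct_add, dotProduct_smul,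
    smul_eq_mul, hadj, hg, dotProduct_comm g g']
  ring

open Matrix in
theorem SimpleGraph.dotProduct_lapMatrix_mulVec {ι : Type*} [Fintype ι] [DecidableEq ι]
    (G : SimpleGraph ι) [DecidableRel G.Adj] (x : ι → ℝ) :
    x ⬝ᵥ G.lapMatrix ℝ *ᵥ x = (∑ i, ∑ j, if G.Adj i j then (x i - x j) ^ 2 else 0) / 2 := by
  rw [← G.lapMatrix_toLinearMap₂' ℝ x, toLinearMap₂'_apply']

open Matrix in
theorem SimpleGraph.dotProduct_lapMatrix_mulVec_le {ι : Type*} [Fintype ι] [DecidableEq ι]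
    (G : SimpleGraph ι) [DecidableRel G.Adj] {D : ℝ} (hD : ∀ i, (G.degree i : ℝ) ≤ D)
    (x : ι → ℝ) : x ⬝ᵥ G.lapMatrix ℝ *ᵥ x ≤ 2 * D * (x ⬝ᵥ x) := by
  have h1 : ∑ i, ∑ j, (if G.Adj i j then x i ^ 2 else 0) ≤ D * (x ⬝ᵥ x) := by
    rw [dotProduct, Finset.mul_sum]
    refine Finset.sum_le_sum fun i _ => ?_
    have h := mul_le_mul_of_nonneg_right (hD i) (sq_nonneg (x i))
    rw [degree_eq_sum_if_adj, Finset.sum_mul] at h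
    simpa [sq] using h
  have h2 : ∑ i, ∑ j, (if G.Adj i j then x j ^ 2 else 0) =
      ∑ i, ∑ j, (if G.Adj i j then x i ^ 2 else 0) := by
    rw [Finset.sum_comm]
    simp only [G.adj_comm]
  have h3 : ∑ i, ∑ j, (if G.Adj i j then (x i - x j) ^ 2 else 0) ≤
      2 * (∑ i, ∑ j, (if G.Adj i j then x i ^ 2 else 0) +
        ∑ i, ∑ j, (if G.Adj i j then x j ^ 2 else 0)) := by
    simp only [← Finset.sum_add_distrib, Finset.mul_sum]
    refine Finset.sum_le_sum fun i _ => Finset.sum_le_sum fun j _ => ?_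
    split_ifs
    · nlinarith [sq_nonneg (x i + x j)]
    · simp
  rw [dotProduct_lapMatrix_mulVec]
  linarith

theorem norm_exp_ofReal_mul_I_sub_le (a b : ℝ) :
    ‖Complex.exp (Complex.I * a) - Complex.exp (Complex.I * b)‖ ≤ |a - b| := by
  have h : Complex.exp (Complex.I * a) - Complex.exp (Complex.I * b) =
      Complex.exp (Complex.I * b) * (Complex.exp (Complex.I * (a - b : ℝ)) - 1) := by
    rw [mul_sub, ← Complex.exp_add, mul_one]
    congr 2
    push_cast
    ring
  rw [h, norm_mul, Complex.norm_exp_I_mul_ofReal, one_mul]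
  exact Real.norm_exp_I_mul_ofReal_sub_one_le

namespace ModOneMulti

/-- The graph `G` on the grid. -/
def gridGraph (d m k : ℕ) : SimpleGraph (V d m) where
  Adj := adj d m k
  symm := ⟨fun _ _ h => ⟨h.1.symm, fun t => abs_sub_comm (_ : ℤ) _ ▸ h.2 t⟩⟩
  loopless := ⟨fun _ h => h.1 rfl⟩

instance (d m k : ℕ) : DecidableRel (gridGraph d m k).Adj := fun i => adjDec d m k i

theorem deg_eq_degree (d m k : ℕ) (i : V d m) : deg d m k i = (gridGraph d m k).degree i := by
  rw [deg, ← SimpleGraph.card_neighborFinset_eq_degree, SimpleGraph.neighborFinset_eq_filter]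
  rfl

theorem lap_eq_lapMatrix (d m k : ℕ) : lap d m k = (gridGraph d m k).lapMatrix ℝ := by
  ext i j
  rw [lap, SimpleGraph.lapMatrix, Matrix.sub_apply, SimpleGraph.degMatrix,
    Matrix.diagonal_apply, SimpleGraph.adjMatrix_apply]
  by_cases h : i = j
  · subst h
    simp [deg_eq_degree]
  · simp only [h, if_false, zero_sub]
    change _ = -(if adj d m k i j then (1 : ℝ) else 0)
    split_ifs <;> simp

theorem degree_gridGraph_le (d m k : ℕ) (i : V d m) :
    ((gridGraph d m k).degree i : ℝ) ≤ (2 * (k : ℝ) + 1) ^ d - 1 := by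
  have h : (insert i (Finset.univ.filter (adj d m k i))).card ≤ (2 * k + 1) ^ d := by
    have hinj : Function.Injective fun (j : V d m) (t : Fin d) => ((j t : ℕ) : ℤ) := by
      intro a b hab
      funext t
      have := congrFun hab t
      simp only [Nat.cast_inj] at this
      exact Fin.ext this
    rw [← Finset.card_image_of_injective _ hinj]
    refine (Finset.card_le_card (t := Fintype.piFinset fun t : Fin d =>
      Finset.Icc (((i t : ℕ) : ℤ) - k) (((i t : ℕ) : ℤ) + k)) ?_).trans ?_
    · intro u hu
      obtain ⟨j, hj, rfl⟩ := Finset.mem_image.mp hu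
      rw [Fintype.mem_piFinset]
      intro t
      rw [Finset.mem_Icc]
      rcases Finset.mem_insert.mp hj with rfl | hj
      · omega
      · have := abs_le.mp ((Finset.mem_filter.mp hj).2.2 t)
        omega
    · rw [Fintype.card_piFinset]
      refine le_of_eq ?_
      have : ∀ t : Fin d, (Finset.Icc (((i t : ℕ) : ℤ) - k) (((i t : ℕ) : ℤ) + k)).card
          = 2 * k + 1 := fun t => by
        rw [Int.card_Icc]
        omega
      simp [this]
  rw [Finset.card_insert_of_notMem (by simp [adj])] at h
  rw [← deg_eq_degree, deg]
  have h' : (((Finset.univ.filter (adj d m k i)).card + 1 : ℕ) : ℝ) ≤ ((2 * k + 1) ^ d : ℕ) :=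
    Nat.cast_le.mpr h
  push_cast at h'
  linarith

open Matrix in
theorem quad_Hmat (d m k : ℕ) (lam : ℝ) (v : V d m ⊕ V d m → ℝ) :
    v ⬝ᵥ Hmat d m k lam *ᵥ v =
      lam * ((v ∘ Sum.inl) ⬝ᵥ (gridGraph d m k).lapMatrix ℝ *ᵥ (v ∘ Sum.inl) +
        (v ∘ Sum.inr) ⬝ᵥ (gridGraph d m k).lapMatrix ℝ *ᵥ (v ∘ Sum.inr)) := by
  rw [Hmat, fromBlocks_mulVec, lap_eq_lapMatrix]
  simp only [dotProduct, Fintype.sum_sum_type, Sum.elim_inl, Sum.elim_inr, zero_mulVec, add_zero,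
    zero_add, smul_mulVec, Pi.smul_apply, smul_eq_mul, Function.comp_apply, mul_add,
    Finset.mul_sum]
  congr 1 <;> exact Finset.sum_congr rfl fun i _ => by ring

theorem isSymm_Hmat (d m k : ℕ) (lam : ℝ) : (Hmat d m k lam).IsSymm := by
  rw [Hmat, lap_eq_lapMatrix]
  have h := ((gridGraph d m k).isSymm_lapMatrix ℝ).smul lam
  exact h.fromBlocks (Matrix.transpose_zero) h

open Matrix in
theorem quad_Hmat_nonneg (d m k : ℕ) {lam : ℝ} (hlam : 0 ≤ lam) (v : V d m ⊕ V d m → ℝ) :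
    0 ≤ v ⬝ᵥ Hmat d m k lam *ᵥ v := by
  rw [quad_Hmat]
  have h (x : V d m → ℝ) : 0 ≤ x ⬝ᵥ (gridGraph d m k).lapMatrix ℝ *ᵥ x := by
    simpa using ((gridGraph d m k).posSemidef_lapMatrix ℝ).dotProduct_mulVec_nonneg x
  exact mul_nonneg hlam (add_nonneg (h _) (h _))

open Matrix in
theorem quad_Hmat_le (d m k : ℕ) {lam : ℝ} (hlam : 0 ≤ lam) (v : V d m ⊕ V d m → ℝ) :
    v ⬝ᵥ Hmat d m k lam *ᵥ v ≤ 2 * lam * ((2 * (k : ℝ) + 1) ^ d - 1) * (v ⬝ᵥ v) := by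
  rw [quad_Hmat]
  have h := (gridGraph d m k).dotProduct_lapMatrix_mulVec_le (degree_gridGraph_le d m k)
  have hv : v ⬝ᵥ v = (v ∘ Sum.inl) ⬝ᵥ (v ∘ Sum.inl) + (v ∘ Sum.inr) ⬝ᵥ (v ∘ Sum.inr) := by
    simp [dotProduct, Fintype.sum_sum_type]
  rw [hv]
  refine (mul_le_mul_of_nonneg_left (add_le_add (h _) (h _)) hlam).trans_eq ?_
  ring

theorem norm_circ_sub_le (a b : ℝ) : ‖circ a - circ b‖ ≤ 2 * Real.pi * |a - b| := by
  have h (t : ℝ) : circ t = Complex.exp (Complex.I * (2 * Real.pi * t : ℝ)) := by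
    rw [circ]
    congr 1
    push_cast
    ring
  rw [h, h]
  refine (norm_exp_ofReal_mul_I_sub_le _ _).trans_eq ?_
  rw [← mul_sub, abs_mul, abs_of_nonneg (by positivity)]

open Matrix in
theorem cvec_dotProduct_self (d m : ℕ) (t : V d m → ℝ) :
    cvec d m t ⬝ᵥ cvec d m t = (m : ℝ) ^ d := by
  have h (a : ℝ) : (circ a).re * (circ a).re + (circ a).im * (circ a).im = 1 := by
    have h1 : ‖circ a‖ = 1 := by
      rw [circ, show (2 * Real.pi * Complex.I * (a : ℂ)) = (2 * Real.pi * a : ℝ) * Complex.I by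
        push_cast; ring]
      exact Complex.norm_exp_ofReal_mul_I _
    rw [← Complex.normSq_apply, Complex.normSq_eq_norm_sq, h1, one_pow]
  simp only [dotProduct, cvec, embed, Fintype.sum_sum_type, Sum.elim_inl, Sum.elim_inr,
    ← Finset.sum_add_distrib, h]
  simp

open Matrix in
theorem quad_Hmat_cvec_le (d m k : ℕ) {lam : ℝ} (hlam : 0 ≤ lam) (t : V d m → ℝ) {C : ℝ}
    (hC : ∀ i j, adj d m k i j → |t i - t j| ≤ C) :
    cvec d m t ⬝ᵥ Hmat d m k lam *ᵥ cvec d m t ≤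
      2 * lam * Real.pi ^ 2 * C ^ 2 * ((2 * (k : ℝ) + 1) ^ d - 1) * (m : ℝ) ^ d := by
  have hterm : ∀ i j, (if (gridGraph d m k).Adj i j then
      ((circ (t i)).re - (circ (t j)).re) ^ 2 else 0) + (if (gridGraph d m k).Adj i j then
      ((circ (t i)).im - (circ (t j)).im) ^ 2 else 0) ≤
      4 * Real.pi ^ 2 * C ^ 2 * (if (gridGraph d m k).Adj i j then 1 else 0) := by
    intro i j
    split_ifs with h
    · have h1 : ((circ (t i)).re - (circ (t j)).re) ^ 2 + ((circ (t i)).im - (circ (t j)).im) ^ 2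
          = ‖circ (t i) - circ (t j)‖ ^ 2 := by
        rw [← Complex.normSq_eq_norm_sq, Complex.normSq_apply]
        simp only [Complex.sub_re, Complex.sub_im]
        ring
      have h2 : ‖circ (t i) - circ (t j)‖ ≤ 2 * Real.pi * C :=
        (norm_circ_sub_le _ _).trans (mul_le_mul_of_nonneg_left (hC i j h) (by positivity))
      rw [h1]
      refine (pow_le_pow_left₀ (norm_nonneg _) h2 2).trans_eq ?_
      ring
    · simp
  have hsum : ∑ i : V d m, ∑ j, 4 * Real.pi ^ 2 * C ^ 2 *
      (if (gridGraph d m k).Adj i j then (1 : ℝ) else 0) ≤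
      4 * Real.pi ^ 2 * C ^ 2 * ((2 * (k : ℝ) + 1) ^ d - 1) * (m : ℝ) ^ d := by
    simp only [← Finset.mul_sum, ← SimpleGraph.degree_eq_sum_if_adj]
    rw [mul_assoc (4 * Real.pi ^ 2 * C ^ 2)]
    refine mul_le_mul_of_nonneg_left ?_ (by positivity : 0 ≤ 4 * Real.pi ^ 2 * C ^ 2)
    refine (Finset.sum_le_sum fun i _ => degree_gridGraph_le d m k i).trans_eq ?_
    simp only [Finset.sum_const, Finset.card_univ, Fintype.card_pi, Fintype.card_fin,
      Finset.prod_const, nsmul_eq_mul, Nat.cast_pow, mul_comm]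
  rw [quad_Hmat, SimpleGraph.dotProduct_lapMatrix_mulVec,
    SimpleGraph.dotProduct_lapMatrix_mulVec, ← add_div]
  have h3 : _ ≤ _ := (Finset.sum_le_sum fun i _ => Finset.sum_le_sum fun j _ =>
    hterm i j).trans hsum
  simp only [Finset.sum_add_distrib] at h3
  refine (mul_le_mul_of_nonneg_left (div_le_div_of_nonneg_right h3 (zero_le_two (α := ℝ))) hlam).trans_eq ?_
  ring

theorem gridPt_mem_Icc {d m : ℕ} (hm : 2 ≤ m) (i : V d m) (t : Fin d) :
    gridPt d m i t ∈ Set.Icc (0 : ℝ) 1 := by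
  have hm' : (2 : ℝ) ≤ m := by exact_mod_cast hm
  have h : ((i t : ℕ) : ℝ) + 1 ≤ m := by exact_mod_cast (i t).isLt
  refine ⟨div_nonneg (Nat.cast_nonneg _) (by linarith), ?_⟩
  rw [gridPt, div_le_one (by linarith)]
  linarith

theorem enorm_gridPt_sub_le {d m k : ℕ} (hm : 2 ≤ m) {i j : V d m} (h : adj d m k i j) :
    enorm d (gridPt d m i - gridPt d m j) ≤ 2 * k * d / m := by
  have hm' : (2 : ℝ) ≤ m := by exact_mod_cast hm
  have hcoord : ∀ t, (gridPt d m i t - gridPt d m j t) ^ 2 ≤ (2 * k / m : ℝ) ^ 2 := by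
    intro t
    have h1 : |((i t : ℕ) : ℝ) - ((j t : ℕ) : ℝ)| ≤ k := by exact_mod_cast h.2 t
    refine sq_le_sq' (abs_le.mp ?_).1 (abs_le.mp ?_).2 <;>
    · rw [gridPt, gridPt, ← sub_div, abs_div, abs_of_pos (show (0 : ℝ) < m - 1 by linarith),
        div_le_div_iff₀ (by linarith) (by linarith)]
      have hk : (0 : ℝ) ≤ k := Nat.cast_nonneg k
      nlinarith [mul_le_mul_of_nonneg_right h1 (show (0 : ℝ) ≤ m by linarith)]
  rw [enorm]
  refine Real.sqrt_le_iff.mpr ⟨by positivity, ?_⟩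
  refine (Finset.sum_le_sum fun t _ => hcoord t).trans ?_
  simp only [Finset.sum_const, Finset.card_univ, Fintype.card_fin, nsmul_eq_mul]
  have hd : (d : ℝ) ≤ (d : ℝ) ^ 2 := by exact_mod_cast Nat.le_self_pow two_ne_zero d
  calc (d : ℝ) * (2 * k / m : ℝ) ^ 2 ≤ (d : ℝ) ^ 2 * (2 * k / m : ℝ) ^ 2 := by gcongr
    _ = _ := by ring

end ModOneMulti

open scoped Matrix

open ModOneMulti in
/-- Assume `m ≥ 2` and `‖z̄ − h̄‖₂ ≤ δ√n` for some `δ ∈ [0,1]`. If `z̄` is not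
orthogonal to `N(H)`, then (TRS) has a unique global minimizer `ĝ`, and it satisfies
`(1/n)⟨h̄, ĝ⟩ ≥ 1 − 3δ/2 − λπ²M²(2k)^{2α}·d^{2α}·((2k+1)^d − 1)/n^{2α/d}
+ (1/(2λ((2k+1)^d − 1) + 1)²)·(1/(2n))·z̄ᵀHz̄`, where `n = m^d`. -/
theorem statement9 (d m k : ℕ) (hd : 1 ≤ d) (hm : 2 ≤ m) (hk₁ : 1 ≤ k) (hk₂ : k ≤ m - 1)
    (lam : ℝ) (hlam : 0 ≤ lam)
    (f : (Fin d → ℝ) → ℝ) (M α : ℝ) (hM : 0 < M) (hα : α ∈ Set.Ioc (0:ℝ) 1)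
    (hf : ∀ x y : Fin d → ℝ, (∀ t, x t ∈ Set.Icc (0:ℝ) 1) → (∀ t, y t ∈ Set.Icc (0:ℝ) 1) →
      |f x - f y| ≤ M * (enorm d (x - y)) ^ α)
    (y : V d m → ℝ) (hy : ∀ i, y i ∈ Set.Ico (0:ℝ) 1)
    (δ : ℝ) (hδ : δ ∈ Set.Icc (0:ℝ) 1)
    (hnoise : norm2 d m (cvec d m y - cvec d m (fun i => f (gridPt d m i))) ≤
      δ * Real.sqrt ((m:ℝ) ^ d))
    (hperp : ¬ perpNull d m k lam (cvec d m y)) :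
    ∃ g, minimizer d m k lam (cvec d m y) g ∧
      (∀ g', minimizer d m k lam (cvec d m y) g' → g' = g) ∧
      (1 / ((m:ℝ)) ^ d) * dotR d m (cvec d m (fun i => f (gridPt d m i))) g ≥
        1 - 3 * δ / 2
          - lam * Real.pi ^ 2 * M ^ 2 * (2 * (k:ℝ)) ^ (2 * α) * (d:ℝ) ^ (2 * α)
              * ((2 * (k:ℝ) + 1) ^ d - 1) / ((m:ℝ) ^ d) ^ (2 * α / (d:ℝ))
          + (1 / (2 * lam * ((2 * (k:ℝ) + 1) ^ d - 1) + 1) ^ 2) *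
              ((1 / (2 * ((m:ℝ)) ^ d)) * quad d m (Hmat d m k lam) (cvec d m y)) := by
  have hm' : (2 : ℝ) ≤ m := by exact_mod_cast hm
  have hm0 : (0 : ℝ) < m := by linarith
  have hN : (0 : ℝ) < (m : ℝ) ^ d := by positivity
  have hd0 : (d : ℝ) ≠ 0 := by
    have : d ≠ 0 := by omega
    exact_mod_cast this
  have hquad : ∀ v, quad d m (Hmat d m k lam) v = v ⬝ᵥ Hmat d m k lam *ᵥ v := fun _ => rfl
  have hdot : ∀ u v, dotR d m u v = u ⬝ᵥ v := fun _ _ => rfl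
  have hfeas : ∀ v, feasible d m v ↔ v ⬝ᵥ v = (m : ℝ) ^ d := fun v => by
    simp only [feasible, dotProduct, sq]
  have hD : (0 : ℝ) ≤ (2 * (k : ℝ) + 1) ^ d - 1 :=
    sub_nonneg.mpr (one_le_pow₀ (by linarith [(Nat.cast_nonneg k : (0 : ℝ) ≤ k)]))
  have hsymm := isSymm_Hmat d m k lam
  have hpos := quad_Hmat_nonneg d m k hlam
  have hHle := quad_Hmat_le d m k hlam
  have hzz := cvec_dotProduct_self d m y
  have hhh := cvec_dotProduct_self d m (fun i => f (gridPt d m i))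
  -- smoothness of the ground truth
  have hsmooth := quad_Hmat_cvec_le d m k hlam (fun i => f (gridPt d m i))
    (C := M * (2 * k * d / m) ^ α) fun i j hij =>
      (hf _ _ (gridPt_mem_Icc hm i) (gridPt_mem_Icc hm j)).trans <|
        mul_le_mul_of_nonneg_left (Real.rpow_le_rpow (Real.sqrt_nonneg _)
          (enorm_gridPt_sub_le hm hij) hα.1.le) hM.le
  have hrate : (M * (2 * k * d / m : ℝ) ^ α) ^ 2 =
      M ^ 2 * (2 * (k : ℝ)) ^ (2 * α) * (d : ℝ) ^ (2 * α) / ((m : ℝ) ^ d) ^ (2 * α / (d : ℝ)) := by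
    have h1 : ((m : ℝ) ^ d) ^ (2 * α / (d : ℝ)) = (m : ℝ) ^ (2 * α) := by
      rw [← Real.rpow_natCast, ← Real.rpow_mul hm0.le, mul_div_cancel₀ _ hd0]
    have h2 : ((2 * k * d / m : ℝ) ^ α) ^ 2 = (2 * k * d / m : ℝ) ^ (2 * α) := by
      rw [← Real.rpow_natCast, ← Real.rpow_mul (by positivity)]
      norm_num [mul_comm]
    rw [mul_pow, h1, h2, Real.div_rpow (by positivity) hm0.le,
      Real.mul_rpow (by positivity) (by positivity)]
    ring
  rw [hrate] at hsmooth
  obtain ⟨v, hv, hzv⟩ : ∃ v, Hmat d m k lam *ᵥ v = 0 ∧ cvec d m y ⬝ᵥ v ≠ 0 := by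
    simpa only [perpNull, hdot, not_forall, exists_prop] using hperp
  obtain ⟨μ, hμ0, hμ1, g, hgg, hg⟩ := exists_shifted_solution _ hsymm hpos _ v hv hzv
  rw [hzz] at hgg
  have hgap : ∀ g', feasible d m g' → objective d m k lam (cvec d m y) g' -
      objective d m k lam (cvec d m y) g =
      (g' - g) ⬝ᵥ Hmat d m k lam *ᵥ (g' - g) + μ * ((g' - g) ⬝ᵥ (g' - g)) := fun g' hg' =>
    shifted_objective_sub _ hsymm g g' _ hg (((hfeas g').mp hg').trans hgg.symm)
  have hnn : ∀ x : V d m ⊕ V d m → ℝ, 0 ≤ x ⬝ᵥ x := fun x => by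
    simpa using dotProduct_star_self_nonneg x
  have hmin : minimizer d m k lam (cvec d m y) g := by
    refine ⟨(hfeas g).mpr hgg, fun g' hg' => ?_⟩
    have := hgap g' hg'
    have := hpos (g' - g)
    have := mul_nonneg hμ0.le (hnn (g' - g))
    linarith
  refine ⟨g, hmin, fun g' hg' => ?_, ?_⟩
  · have h1 := hgap g' hg'.1
    have h2 := hg'.2 g hmin.1
    have h3 := hpos (g' - g)
    have h4 : (g' - g) ⬝ᵥ (g' - g) = 0 := by
      refine le_antisymm ?_ (hnn _)
      refine le_of_mul_le_mul_left ?_ hμ0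
      linarith
    exact sub_eq_zero.mp (dotProduct_self_eq_zero.mp h4)
  · have hopt := hmin.2 _ ((hfeas _).mpr hhh)
    simp only [objective, hquad, hdot] at hopt ⊢
    have hspec := shifted_quadratic_bound _ hsymm hpos (by positivity) hHle hμ0.le hμ1 g _ hg
    set h := cvec d m (fun i => f (gridPt d m i))
    set z := cvec d m y
    set N : ℝ := (m : ℝ) ^ d
    set D : ℝ := (2 * (k : ℝ) + 1) ^ d - 1
    have hdist : (z - h) ⬝ᵥ (z - h) ≤ δ ^ 2 * N := by
      have h1 := pow_le_pow_left₀ (Real.sqrt_nonneg _) hnoise 2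
      rw [Real.sq_sqrt (Finset.sum_nonneg fun i _ => sq_nonneg _), mul_pow,
        Real.sq_sqrt hN.le] at h1
      simpa only [dotProduct, sq] using h1
    have hcs : g ⬝ᵥ (z - h) ≤ δ * N := by
      have h1 : (g ⬝ᵥ (z - h)) ^ 2 ≤ (g ⬝ᵥ g) * ((z - h) ⬝ᵥ (z - h)) := by
        simpa [dotProduct, sq] using Finset.sum_mul_sq_le_sq_mul_sq Finset.univ g (z - h)
      rw [hgg] at h1
      refine (abs_le_of_sq_le_sq' ?_ (mul_nonneg hδ.1 hN.le)).2
      nlinarith [mul_le_mul_of_nonneg_left hdist hN.le]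
    have hzh : (z - h) ⬝ᵥ (z - h) = 2 * N - 2 * (h ⬝ᵥ z) := by
      simp only [sub_dotProduct, dotProduct_sub, hzz, hhh, dotProduct_comm z h]
      ring
    rw [dotProduct_sub, dotProduct_comm g h] at hcs
    have hδ2 : δ ^ 2 * N ≤ δ * N :=
      mul_le_mul_of_nonneg_right (by nlinarith [hδ.1, hδ.2]) hN.le
    have hspec' : 1 / (2 * lam * D + 1) ^ 2 * (z ⬝ᵥ Hmat d m k lam *ᵥ z) ≤
        g ⬝ᵥ Hmat d m k lam *ᵥ g := by
      rw [one_div, inv_mul_le_iff₀ (by positivity)]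
      exact hspec
    rw [ge_iff_le, ← mul_le_mul_iff_right₀ hN]
    have hR : N * (1 / N * (h ⬝ᵥ g)) = h ⬝ᵥ g := by field_simp
    have hS : N * (1 / (2 * lam * D + 1) ^ 2 * (1 / (2 * N) * (z ⬝ᵥ Hmat d m k lam *ᵥ z))) =
        1 / (2 * lam * D + 1) ^ 2 * (z ⬝ᵥ Hmat d m k lam *ᵥ z) / 2 := by field_simp
    rw [hR, mul_add, hS]
    have hT : h ⬝ᵥ Hmat d m k lam *ᵥ h ≤ 2 * (N * (lam * Real.pi ^ 2 * M ^ 2 *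
        (2 * (k : ℝ)) ^ (2 * α) * (d : ℝ) ^ (2 * α) * D / N ^ (2 * α / (d : ℝ)))) :=
      hsmooth.trans_eq (by ring)
    linarith
end
end
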